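/- Let 𝒳 be a finite set and x ↦ W_x a pure-state classical–quantum channel on ℂ^d. For all ε, δ₁, δ₂ ∈ (0,1) with δ₁ + δ₂ < ε and ε + δ₁ + 2δ₂ < 1, the maximal code size M(ε) satisfies both log M(ε) ≥ max_P H_s^{ε−δ₁−δ₂}(W_P) − log((1−ε)/(δ₁δ₂)) and log M(ε) ≤ max_P H_s^{ε+δ₁+2δ₂}(W_P) + log(1/(δ₁δ₂²)), where the maxima run over all probability distributions P on 𝒳. -/

import Mathlib

open scoped ComplexOrder

/-- Projection onto the sum of eigenspaces of a Hermitian matrix with nonnegative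
eigenvalues (junk value `0` if the matrix is not Hermitian). -/
noncomputable def projNonneg {n : Type*} [Fintype n] [DecidableEq n]
    (A : Matrix n n ℂ) : Matrix n n ℂ :=
  if hA : A.IsHermitian then
    (hA.eigenvectorUnitary : Matrix n n ℂ) *
      Matrix.diagonal (fun i => if 0 ≤ hA.eigenvalues i then (1 : ℂ) else 0) *
      star (hA.eigenvectorUnitary : Matrix n n ℂ)
  else 0

/-- A pure state: a rank-one orthogonal projection, equivalently a Hermitian
idempotent of trace one. -/
def IsPureState {n : Type*} [Fintype n] (ρ : Matrix n n ℂ) : Prop :=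
  ρ.IsHermitian ∧ ρ * ρ = ρ ∧ ρ.trace = 1

/-- A state: a positive semidefinite matrix of trace one. -/
def IsState {n : Type*} [Fintype n] (ρ : Matrix n n ℂ) : Prop :=
  ρ.PosSemidef ∧ ρ.trace = 1

/-- `H_s^ε(ρ) = sup {λ | tr(ρ {ρ ≥ e^{-λ} I}) ≤ ε}`. -/
noncomputable def Hs {n : Type*} [Fintype n] [DecidableEq n]
    (ε : ℝ) (ρ : Matrix n n ℂ) : ℝ :=
  sSup {lam : ℝ |
    ((ρ * projNonneg (ρ - Real.exp (-lam) • (1 : Matrix n n ℂ))).trace).re ≤ ε}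

/-- The average state `W_P = Σ_x P(x) W_x`. -/
noncomputable def WPavg {X : Type*} [Fintype X] {n : Type*} [Fintype n]
    (P : X → ℝ) (W : X → Matrix n n ℂ) : Matrix n n ℂ :=
  ∑ x, (P x : ℂ) • W x

/-- `M` messages can be sent through the cq-channel `W` with error probability
at most `ε`: there are codewords `x₁,…,x_M` and a sub-POVM `Q₁,…,Q_M` with
`tr(W_{xᵢ} Qᵢ) ≥ 1 − ε` for all `i`. -/
def CodeAchievable {X : Type*} {n : Type*} [Fintype n] [DecidableEq n]
    (W : X → Matrix n n ℂ) (ε : ℝ) (M : ℕ) : Prop :=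
  ∃ (enc : Fin M → X) (Q : Fin M → Matrix n n ℂ),
    (∀ i, (Q i).PosSemidef) ∧ ((1 : Matrix n n ℂ) - ∑ i, Q i).PosSemidef ∧
    ∀ i, 1 - ε ≤ ((W (enc i) * Q i).trace).re

/-- `M(ε)`: the maximal code size. -/
noncomputable def Mcode {X : Type*} {n : Type*} [Fintype n] [DecidableEq n]
    (W : X → Matrix n n ℂ) (ε : ℝ) : ℕ :=
  sSup {M : ℕ | CodeAchievable W ε M}

namespace Matrix

variable {n : Type*} [Fintype n]

theorem PosSemidef.re_trace_nonneg {A : Matrix n n ℂ} (hA : A.PosSemidef) : 0 ≤ A.trace.re :=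
  (Complex.le_def.mp hA.trace_nonneg).1

theorem IsHermitian.posSemidef_of_mul_self {S : Matrix n n ℂ} (hS : S.IsHermitian)
    (h : S * S = S) : S.PosSemidef := by
  have := posSemidef_conjTranspose_mul_self S
  rwa [hS.eq, h] at this

variable [DecidableEq n]

open scoped MatrixOrder Matrix.Norms.L2Operator in
theorem PosSemidef.re_trace_mul_nonneg {A B : Matrix n n ℂ} (hA : A.PosSemidef)
    (hB : B.PosSemidef) : 0 ≤ (A * B).trace.re := by
  obtain ⟨C, rfl⟩ := CStarAlgebra.nonneg_iff_eq_star_mul_self.mp hB.nonneg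
  rw [Matrix.star_eq_conjTranspose]
  rw [← Matrix.mul_assoc, Matrix.trace_mul_comm, ← Matrix.mul_assoc]
  exact (hA.mul_mul_conjTranspose_same C).re_trace_nonneg

theorem re_trace_mul_le_re_trace_mul {A B C : Matrix n n ℂ} (hA : A.PosSemidef)
    (hBC : (C - B).PosSemidef) : (A * B).trace.re ≤ (A * C).trace.re := by
  have h := hA.re_trace_mul_nonneg hBC
  rw [Matrix.mul_sub, trace_sub, Complex.sub_re] at h
  linarith

theorem re_trace_mul_le_re_trace {A B : Matrix n n ℂ} (hA : A.PosSemidef)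
    (hB : (1 - B).PosSemidef) : (A * B).trace.re ≤ A.trace.re := by
  simpa using re_trace_mul_le_re_trace_mul hA hB

theorem IsHermitian.posSemidef_one_sub_of_mul_self {S : Matrix n n ℂ} (hS : S.IsHermitian)
    (h : S * S = S) : (1 - S).PosSemidef :=
  (isHermitian_one.sub hS).posSemidef_of_mul_self (by simp [Matrix.sub_mul, Matrix.mul_sub, h])

/-- An effect `R` satisfies `R² ≤ R`. -/
theorem PosSemidef.sub_mul_self {R : Matrix n n ℂ} (hR : R.PosSemidef)
    (hR1 : (1 - R).PosSemidef) : (R - R * R).PosSemidef := by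
  have h := (hR1.conjTranspose_mul_mul_same R).add (hR.conjTranspose_mul_mul_same (1 - R))
  rw [hR.isHermitian.eq, hR1.isHermitian.eq] at h
  convert h using 1
  noncomm_ring

/-- Pinching inequality for the two-outcome projective measurement `{S, 1 - S}`. -/
theorem PosSemidef.pinching {Q S : Matrix n n ℂ} (hQ : Q.PosSemidef) (hS : S.IsHermitian)
    {s : ℝ} (hs : 0 < s) :
    ((1 + 1 / s) • (S * Q * S) + (1 + s) • ((1 - S) * Q * (1 - S)) - Q).PosSemidef := by
  have hN : (S - s • (1 - S)).IsHermitian := by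
    rw [IsHermitian, conjTranspose_sub, conjTranspose_smul, conjTranspose_sub,
      conjTranspose_one, hS.eq, star_trivial]
  have h := (hQ.conjTranspose_mul_mul_same (S - s • (1 - S))).smul
    (show (0 : ℝ) ≤ 1 / s by positivity)
  rw [hN.eq] at h
  convert h using 1
  generalize hT : 1 - S = T
  have hQd : Q = (S + T) * Q * (S + T) := by rw [← hT]; noncomm_ring
  nth_rewrite 3 [hQd]
  simp only [Matrix.sub_mul, Matrix.mul_sub, Matrix.add_mul, Matrix.mul_add, Matrix.smul_mul,
    Matrix.mul_smul, smul_sub, smul_smul, add_smul, one_smul]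
  have h1 : 1 / s * s = 1 := by field_simp
  have h2 : 1 / s * (s * s) = s := by field_simp
  simp only [h1, h2, one_smul]
  abel

/-- Gentle-measurement type bound: a projection `S` capturing little of the effect `Q` captures
little of any state that passes the test `Q` with high probability. -/
theorem re_trace_mul_pinching_le {W Q S : Matrix n n ℂ} (hW : W.PosSemidef)
    (hW1 : (1 - W).PosSemidef) (htr : W.trace = 1) (hQ : Q.PosSemidef)
    (hQ1 : (1 - Q).PosSemidef) (hS : S.IsHermitian) (hSS : S * S = S) {s : ℝ} (hs : 0 < s) :
    (W * Q).trace.re + (1 + s) * (W * S).trace.re ≤ (1 + 1 / s) * (Q * S).trace.re + (1 + s) := by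
  have hp := re_trace_mul_le_re_trace_mul hW (hQ.pinching hS hs)
  have hSQS : (S * Q * S).PosSemidef := by
    simpa [hS.eq] using hQ.conjTranspose_mul_mul_same S
  have h1 : (W * (S * Q * S)).trace.re ≤ (Q * S).trace.re := by
    rw [trace_mul_comm]
    refine (re_trace_mul_le_re_trace hSQS hW1).trans_eq ?_
    rw [Matrix.mul_assoc, trace_mul_comm, Matrix.mul_assoc, hSS]
  have hT : (1 - S).IsHermitian := isHermitian_one.sub hS
  have hTT : (1 - S) * (1 - S) = 1 - S := by simp [Matrix.sub_mul, Matrix.mul_sub, hSS]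
  have h2 : (W * ((1 - S) * Q * (1 - S))).trace.re ≤ (W * (1 - S)).trace.re := by
    refine re_trace_mul_le_re_trace_mul hW ?_
    have h := hQ1.conjTranspose_mul_mul_same (1 - S)
    rwa [hT.eq, Matrix.mul_sub (1 - S) 1 Q, Matrix.sub_mul _ _ (1 - S), Matrix.mul_one, hTT] at h
  have h3 : (W * (1 - S)).trace.re = 1 - (W * S).trace.re := by
    simp [Matrix.mul_sub, htr]
  rw [Matrix.mul_add, Matrix.mul_smul, Matrix.mul_smul, trace_add, trace_smul, trace_smul,
    Complex.add_re, Complex.smul_re, Complex.smul_re, smul_eq_mul, smul_eq_mul] at hp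
  have h4 : (1 + 1 / s) * (W * (S * Q * S)).trace.re ≤ (1 + 1 / s) * (Q * S).trace.re :=
    mul_le_mul_of_nonneg_left h1 (by positivity)
  have h5 := mul_le_mul_of_nonneg_left h2 (show 0 ≤ 1 + s by positivity)
  rw [h3] at h5
  linarith

end Matrix

open Matrix

theorem isHermitian_sub_smul_one {n : Type*} [DecidableEq n] {ρ : Matrix n n ℂ}
    (hρ : ρ.IsHermitian) (c : ℝ) :
    (ρ - c • (1 : Matrix n n ℂ)).IsHermitian := by
  rw [IsHermitian, conjTranspose_sub, conjTranspose_smul, conjTranspose_one, hρ.eq, star_trivial]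

section projNonneg

variable {n : Type*} [Fintype n] [DecidableEq n]

theorem projNonneg_isHermitian (A : Matrix n n ℂ) : (projNonneg A).IsHermitian := by
  unfold projNonneg
  split_ifs with hA
  · rw [Matrix.star_eq_conjTranspose]
    refine isHermitian_mul_mul_conjTranspose _ (isHermitian_diagonal_iff.mpr fun i => ?_)
    split_ifs <;> simp [IsSelfAdjoint]
  · exact isHermitian_zero

theorem projNonneg_mul_self (A : Matrix n n ℂ) : projNonneg A * projNonneg A = projNonneg A := by
  unfold projNonneg
  split_ifs with hA
  · set U := hA.eigenvectorUnitary
    set D := Matrix.diagonal (fun i => if 0 ≤ hA.eigenvalues i then (1 : ℂ) else 0) with hD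
    have hU : star (U : Matrix n n ℂ) * U = 1 := Unitary.coe_star_mul_self U
    have hDD : D * D = D := by
      rw [hD, diagonal_mul_diagonal]
      congr 1; ext i; split_ifs <;> simp
    calc (U : Matrix n n ℂ) * D * star (U : Matrix n n ℂ) * (U * D * star (U : Matrix n n ℂ))
        = U * D * (star (U : Matrix n n ℂ) * U) * D * star (U : Matrix n n ℂ) := by
          simp only [Matrix.mul_assoc]
      _ = U * D * star (U : Matrix n n ℂ) := by
          rw [hU, Matrix.mul_one, Matrix.mul_assoc (U : Matrix n n ℂ) D D, hDD]
  · simp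

theorem mul_projNonneg_eq {A : Matrix n n ℂ} (hA : A.IsHermitian) :
    A * projNonneg A = (hA.eigenvectorUnitary : Matrix n n ℂ) *
      Matrix.diagonal (fun i => ((max (hA.eigenvalues i) 0 : ℝ) : ℂ)) *
      star (hA.eigenvectorUnitary : Matrix n n ℂ) := by
  have hU : star (hA.eigenvectorUnitary : Matrix n n ℂ) * hA.eigenvectorUnitary = 1 :=
    Unitary.coe_star_mul_self _
  have hs := hA.spectral_theorem
  rw [Unitary.conjStarAlgAut_apply] at hs
  rw [projNonneg, dif_pos hA]
  set U := (hA.eigenvectorUnitary : Matrix n n ℂ)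
  set E := Matrix.diagonal (fun i => if 0 ≤ hA.eigenvalues i then (1 : ℂ) else 0) with hE
  set D := Matrix.diagonal (RCLike.ofReal ∘ hA.eigenvalues : n → ℂ) with hD
  have hDE : D * E = Matrix.diagonal (fun i => ((max (hA.eigenvalues i) 0 : ℝ) : ℂ)) := by
    rw [hE, hD, diagonal_mul_diagonal]
    congr 1; ext i
    split_ifs with h
    · simp [max_eq_left h]
    · simp [max_eq_right (not_le.mp h).le]
  calc A * (U * E * star U) = U * D * (star U * U) * E * star U := by
        nth_rewrite 1 [hs]; simp only [Matrix.mul_assoc]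
    _ = U * (D * E) * star U := by rw [hU]; simp only [Matrix.mul_assoc, Matrix.one_mul]
    _ = _ := by rw [hDE]

theorem mul_projNonneg_posSemidef {A : Matrix n n ℂ} (hA : A.IsHermitian) :
    (A * projNonneg A).PosSemidef := by
  rw [mul_projNonneg_eq hA, Matrix.star_eq_conjTranspose]
  refine PosSemidef.mul_mul_conjTranspose_same (PosSemidef.diagonal fun i => ?_) _
  exact Complex.zero_le_real.mpr (le_max_right _ _)

theorem mul_projNonneg_sub_posSemidef {A : Matrix n n ℂ} (hA : A.IsHermitian) :
    (A * projNonneg A - A).PosSemidef := by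
  have hs := hA.spectral_theorem
  rw [Unitary.conjStarAlgAut_apply] at hs
  rw [mul_projNonneg_eq hA]
  nth_rewrite 4 [hs]
  rw [← Matrix.sub_mul, ← Matrix.mul_sub, Matrix.star_eq_conjTranspose, diagonal_sub]
  refine PosSemidef.mul_mul_conjTranspose_same (PosSemidef.diagonal fun i => ?_) _
  simp

variable {ρ : Matrix n n ℂ} {c : ℝ}

theorem re_trace_sub_smul_one_mul (ρ B : Matrix n n ℂ) (c : ℝ) :
    ((ρ - c • (1 : Matrix n n ℂ)) * B).trace.re = (ρ * B).trace.re - c * B.trace.re := by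
  simp [Matrix.sub_mul]

theorem mul_re_trace_projNonneg_le (hρ : ρ.IsHermitian) :
    c * (projNonneg (ρ - c • (1 : Matrix n n ℂ))).trace.re ≤
      (ρ * projNonneg (ρ - c • (1 : Matrix n n ℂ))).trace.re := by
  have h := (mul_projNonneg_posSemidef (isHermitian_sub_smul_one hρ c)).re_trace_nonneg
  rw [re_trace_sub_smul_one_mul] at h
  linarith

/-- Neyman–Pearson inequality for the spectral projection of `ρ` at threshold `c`. -/
theorem re_trace_mul_le_projNonneg (hρ : ρ.IsHermitian) (hc : 0 ≤ c) {Q : Matrix n n ℂ}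
    (hQ : Q.PosSemidef) (hQ1 : (1 - Q).PosSemidef) :
    (ρ * Q).trace.re ≤
      (ρ * projNonneg (ρ - c • (1 : Matrix n n ℂ))).trace.re + c * Q.trace.re := by
  have hA := isHermitian_sub_smul_one hρ c
  have h1 := re_trace_mul_le_re_trace_mul hQ (mul_projNonneg_sub_posSemidef hA)
  have h2 := re_trace_mul_le_re_trace (mul_projNonneg_posSemidef hA) hQ1
  rw [trace_mul_comm, trace_mul_comm Q] at h1
  rw [re_trace_sub_smul_one_mul] at h1
  rw [re_trace_sub_smul_one_mul ρ (projNonneg _)] at h2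
  have h3 : 0 ≤ c * (projNonneg (ρ - c • (1 : Matrix n n ℂ))).trace.re :=
    mul_nonneg hc ((projNonneg_isHermitian _).posSemidef_of_mul_self
      (projNonneg_mul_self _)).re_trace_nonneg
  linarith

theorem exists_mem_Hs_set (hρ : ρ.PosSemidef) (hρ1 : (1 - ρ).PosSemidef) {ε : ℝ} (hε : 0 ≤ ε) :
    {lam : ℝ | ((ρ * projNonneg (ρ - Real.exp (-lam) • (1 : Matrix n n ℂ))).trace).re
      ≤ ε}.Nonempty := by
  refine ⟨-1, ?_⟩
  rw [Set.mem_ofPred_eq, neg_neg]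
  have h1 := mul_re_trace_projNonneg_le (c := Real.exp 1) hρ.isHermitian
  set S := projNonneg (ρ - Real.exp 1 • (1 : Matrix n n ℂ))
  have hS : S.PosSemidef := (projNonneg_isHermitian _).posSemidef_of_mul_self
    (projNonneg_mul_self _)
  have h2 := re_trace_mul_le_re_trace hS hρ1
  rw [trace_mul_comm] at h2
  have h3 := hS.re_trace_nonneg
  have h4 := Real.add_one_lt_exp (one_ne_zero)
  nlinarith

theorem le_of_mem_Hs_set (hρ : IsState ρ) {ε : ℝ} (hε : ε < 1) {lam : ℝ}
    (h : ((ρ * projNonneg (ρ - Real.exp (-lam) • (1 : Matrix n n ℂ))).trace).re ≤ ε) :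
    lam ≤ Fintype.card n / (1 - ε) := by
  have h1 := re_trace_mul_le_projNonneg hρ.1.isHermitian (Real.exp_pos (-lam)).le
    (Q := 1) PosSemidef.one (by simpa using PosSemidef.zero)
  rw [Matrix.mul_one, hρ.2, trace_one, Complex.one_re, Complex.natCast_re] at h1
  have h2 : 1 - ε ≤ Real.exp (-lam) * Fintype.card n := by linarith
  have h3 : Real.exp lam * (1 - ε) ≤ Fintype.card n := by
    calc Real.exp lam * (1 - ε) ≤ Real.exp lam * (Real.exp (-lam) * Fintype.card n) := by gcongr
      _ = Fintype.card n := by rw [← mul_assoc, ← Real.exp_add]; simp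
  rw [le_div_iff₀ (by linarith)]
  have h4 := Real.add_one_le_exp lam
  nlinarith

theorem bddAbove_Hs_set (hρ : IsState ρ) {ε : ℝ} (hε : ε < 1) :
    BddAbove {lam : ℝ | ((ρ * projNonneg (ρ - Real.exp (-lam) • (1 : Matrix n n ℂ))).trace).re
      ≤ ε} :=
  ⟨_, fun _ h => le_of_mem_Hs_set hρ hε h⟩

end projNonneg

section IsPureState

variable {n : Type*} [Fintype n] {W : Matrix n n ℂ}

theorem IsPureState.posSemidef (hW : IsPureState W) : W.PosSemidef :=
  hW.1.posSemidef_of_mul_self hW.2.1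

theorem IsPureState.exists_eq_smul_vecMulVec (hW : IsPureState W) :
    ∃ (c : ℂ) (w : n → ℂ), W = c • vecMulVec w (star w) := by
  have hne : W ≠ 0 := by
    rintro rfl
    simpa using hW.2.2
  obtain ⟨j, hj⟩ : ∃ j, W.col j ≠ 0 := by
    by_contra! h
    exact hne (by ext a b; exact congrFun (h b) a)
  set w := W.col j with hw
  have hWw : W *ᵥ w = w := by
    ext a
    exact congrFun (congrFun hW.2.1 a) j
  have hwW : star w ᵥ* W = star w := by
    have := congrArg star hWw
    rwa [star_mulVec, hW.1.eq] at this
  have hww : star w ⬝ᵥ w ≠ 0 := by simpa using hj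
  refine ⟨(star w ⬝ᵥ w)⁻¹, w, ?_⟩
  set P := (star w ⬝ᵥ w)⁻¹ • vecMulVec w (star w) with hP
  have hPH : P.IsHermitian := by
    have hc : star (star w ⬝ᵥ w) = star w ⬝ᵥ w :=
      (star_dotProduct w w).symm
    rw [IsHermitian, hP, conjTranspose_smul, conjTranspose_vecMulVec, star_star, star_inv₀, hc]
  have hWP : W * P = P := by rw [hP, Matrix.mul_smul, mul_vecMulVec, hWw]
  have hPW : P * W = P := by rw [hP, Matrix.smul_mul, vecMulVec_mul, hwW]
  have hPP : P * P = P := by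
    rw [hP, Matrix.smul_mul, Matrix.mul_smul, vecMulVec_mul_vecMulVec]
    rw [vecMulVec_smul, smul_smul (star w ⬝ᵥ w)⁻¹ (star w ⬝ᵥ w), inv_mul_cancel₀ hww, one_smul]
  have hPt : P.trace = 1 := by
    rw [hP, trace_smul, trace_vecMulVec, dotProduct_comm w, smul_eq_mul, inv_mul_cancel₀ hww]
  rw [← sub_eq_zero, ← trace_conjTranspose_mul_self_eq_zero_iff, (hW.1.sub hPH).eq]
  simp [Matrix.sub_mul, Matrix.mul_sub, hWP, hPW, hPP, hW.2.1, hW.2.2, hPt]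

theorem IsPureState.mul_mul_self (hW : IsPureState W) (R : Matrix n n ℂ) :
    W * R * W = (W * R).trace • W := by
  obtain ⟨c, w, rfl⟩ := hW.exists_eq_smul_vecMulVec
  simp only [Matrix.smul_mul, Matrix.mul_smul, vecMulVec_mul _ _ R, vecMulVec_mul_vecMulVec,
    trace_smul, trace_vecMulVec, smul_smul, vecMulVec_smul, smul_eq_mul, dotProduct_comm w]
  congr 1
  ring

variable [DecidableEq n]

theorem IsPureState.posSemidef_one_sub (hW : IsPureState W) : (1 - W).PosSemidef :=
  hW.1.posSemidef_one_sub_of_mul_self hW.2.1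

/-- A pure state accepted by the effect `R` is accepted equally well by some effect below `R`
of trace at most one. -/
theorem IsPureState.exists_effect_le (hW : IsPureState W) {R : Matrix n n ℂ} (hR : R.PosSemidef)
    (hR1 : (1 - R).PosSemidef) (hpos : 0 < (W * R).trace.re) :
    ∃ Q : Matrix n n ℂ, Q.PosSemidef ∧ (R - Q).PosSemidef ∧ Q.trace.re ≤ 1 ∧
      (W * Q).trace.re = (W * R).trace.re := by
  set r := (W * R).trace.re with hr
  have htr : (W * R).trace = (r : ℂ) := by
    refine Complex.ext rfl ?_
    have h : star (W * R).trace = (W * R).trace := by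
      rw [← trace_conjTranspose, conjTranspose_mul, hW.1.eq, hR.isHermitian.eq, trace_mul_comm]
    rw [Complex.ofReal_im]
    exact Complex.conj_eq_iff_im.mp h
  have hWRW : W * R * W = r • W := by
    rw [hW.mul_mul_self, htr]; exact Complex.coe_smul r W
  have hRWR : (R * W * R).PosSemidef := by
    simpa [hR.isHermitian.eq] using hW.posSemidef.conjTranspose_mul_mul_same R
  have hRWRWR : R * W * R * W * R = r • (R * W * R) := by
    calc R * W * R * W * R = R * (W * R * W) * R := by simp only [Matrix.mul_assoc]
      _ = _ := by rw [hWRW]; simp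
  refine ⟨r⁻¹ • (R * W * R), hRWR.smul (by positivity), ?_, ?_, ?_⟩
  · have hN : (1 - r⁻¹ • (W * R))ᴴ = 1 - r⁻¹ • (R * W) := by
      rw [conjTranspose_sub, conjTranspose_smul, conjTranspose_mul, conjTranspose_one, hW.1.eq,
        hR.isHermitian.eq, star_trivial]
    have h := hR.conjTranspose_mul_mul_same (1 - r⁻¹ • (W * R))
    rw [hN] at h
    convert h using 1
    simp only [Matrix.sub_mul, Matrix.mul_sub, Matrix.one_mul, Matrix.mul_one, Matrix.smul_mul,
      Matrix.mul_smul, ← Matrix.mul_assoc, hRWRWR, inv_smul_smul₀ hpos.ne',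
      sub_self, smul_zero, sub_zero]
  · have h := re_trace_mul_le_re_trace_mul hW.posSemidef (hR.sub_mul_self hR1)
    rw [← hr] at h
    rw [trace_smul, Complex.smul_re, smul_eq_mul, trace_mul_comm, ← Matrix.mul_assoc,
      trace_mul_comm, inv_mul_le_iff₀ hpos, mul_one]
    exact h
  · rw [Matrix.mul_smul, ← Matrix.mul_assoc, ← Matrix.mul_assoc, hWRW, Matrix.smul_mul, smul_smul,
      inv_mul_cancel₀ hpos.ne', one_smul]

end IsPureState

section WPavg

variable {X : Type*} [Fintype X] {n : Type*} [Fintype n] {W : X → Matrix n n ℂ} {P : X → ℝ}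

theorem re_trace_WPavg_mul (P : X → ℝ) (W : X → Matrix n n ℂ) (B : Matrix n n ℂ) :
    (WPavg P W * B).trace.re = ∑ x, P x * (W x * B).trace.re := by
  simp [WPavg, Finset.sum_mul, trace_sum]

theorem isState_WPavg (hW : ∀ x, IsPureState (W x)) (hP : ∀ x, 0 ≤ P x) (hP1 : ∑ x, P x = 1) :
    IsState (WPavg P W) := by
  refine ⟨posSemidef_sum _ fun x _ => (hW x).posSemidef.smul (Complex.zero_le_real.mpr (hP x)), ?_⟩
  simp only [WPavg, trace_sum, trace_smul, (hW _).2.2, smul_eq_mul, mul_one]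
  exact_mod_cast hP1

variable [DecidableEq n]

theorem posSemidef_one_sub_WPavg (hW : ∀ x, IsPureState (W x)) (hP : ∀ x, 0 ≤ P x)
    (hP1 : ∑ x, P x = 1) : (1 - WPavg P W).PosSemidef := by
  have h : 1 - WPavg P W = ∑ x, (P x : ℂ) • (1 - W x) := by
    simp only [WPavg, smul_sub, Finset.sum_sub_distrib, ← Finset.sum_smul]
    rw [← Complex.ofReal_sum, hP1, Complex.ofReal_one, one_smul]
  rw [h]
  exact posSemidef_sum _ fun x _ =>
    (hW x).posSemidef_one_sub.smul (Complex.zero_le_real.mpr (hP x))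

end WPavg

section codes

variable {X : Type*} {n : Type*} [Fintype n] [DecidableEq n] {W : X → Matrix n n ℂ} {ε : ℝ}

theorem CodeAchievable.le_div (hW : ∀ x, IsPureState (W x)) (hε : ε < 1) {M : ℕ}
    (h : CodeAchievable W ε M) : (M : ℝ) ≤ Fintype.card n / (1 - ε) := by
  obtain ⟨enc, Q, hQ, hQ1, hs⟩ := h
  rw [le_div_iff₀ (by linarith)]
  have h1 : ∀ i, 1 - ε ≤ (Q i).trace.re := fun i => by
    refine (hs i).trans ?_
    rw [trace_mul_comm]
    exact re_trace_mul_le_re_trace (hQ i) (hW _).posSemidef_one_sub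
  have h2 : (∑ i, (Q i)).trace.re ≤ Fintype.card n := by
    have := hQ1.re_trace_nonneg
    rw [trace_sub, trace_one, Complex.sub_re, Complex.natCast_re] at this
    linarith
  rw [trace_sum, Complex.re_sum] at h2
  calc (M : ℝ) * (1 - ε) = ∑ _i : Fin M, (1 - ε) := by simp [mul_sub]
    _ ≤ _ := (Finset.sum_le_sum fun i _ => h1 i).trans h2

theorem bddAbove_codeAchievable (hW : ∀ x, IsPureState (W x)) (hε : ε < 1) :
    BddAbove {M : ℕ | CodeAchievable W ε M} :=
  ⟨⌊Fintype.card n / (1 - ε)⌋₊, fun _ h => Nat.le_floor (h.le_div hW hε)⟩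

theorem codeAchievable_one [Nonempty X] (hW : ∀ x, IsPureState (W x)) (hε : 0 ≤ ε) :
    CodeAchievable W ε 1 :=
  ⟨fun _ => Classical.arbitrary X, fun _ => 1, fun _ => PosSemidef.one,
    by simpa using PosSemidef.zero, fun _ => by simp [(hW _).2.2, hε]⟩

theorem codeAchievable_Mcode [Nonempty X] (hW : ∀ x, IsPureState (W x)) (hε : 0 ≤ ε)
    (hε1 : ε < 1) : CodeAchievable W ε (Mcode W ε) :=
  Nat.sSup_mem ⟨1, codeAchievable_one hW hε⟩ (bddAbove_codeAchievable hW hε1)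

theorem one_le_Mcode [Nonempty X] (hW : ∀ x, IsPureState (W x)) (hε : 0 ≤ ε) (hε1 : ε < 1) :
    1 ≤ Mcode W ε :=
  le_csSup (bddAbove_codeAchievable hW hε1) (codeAchievable_one hW hε)

/-- A code with small-trace effects that cannot be extended: its total effect has trace at most
`Mcode W ε` and detects every channel output with probability at least `ε`. -/
theorem exists_saturated_effect (hW : ∀ x, IsPureState (W x)) (hε1 : ε < 1) :
    ∃ Q : Matrix n n ℂ, Q.PosSemidef ∧ (1 - Q).PosSemidef ∧ Q.trace.re ≤ Mcode W ε ∧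
      ∀ x, ε ≤ (W x * Q).trace.re := by
  let s : Set ℕ := {M | ∃ (enc : Fin M → X) (Q : Fin M → Matrix n n ℂ),
    (∀ i, (Q i).PosSemidef) ∧ (1 - ∑ i, Q i).PosSemidef ∧
    (∀ i, 1 - ε ≤ ((W (enc i) * Q i).trace).re) ∧ ∀ i, (Q i).trace.re ≤ 1}
  have hsub : s ⊆ {M : ℕ | CodeAchievable W ε M} := by
    rintro M ⟨enc, Q, hQ, hQ1, hs, -⟩
    exact ⟨enc, Q, hQ, hQ1, hs⟩
  have hbdd : BddAbove s := (bddAbove_codeAchievable hW hε1).mono hsub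
  have hmem : sSup s ∈ s := by
    refine Nat.sSup_mem ⟨0, Fin.elim0, Fin.elim0, fun i => i.elim0, ?_, fun i => i.elim0,
      fun i => i.elim0⟩ hbdd
    simpa using PosSemidef.one
  have hle : sSup s ≤ Mcode W ε := le_csSup (bddAbove_codeAchievable hW hε1) (hsub hmem)
  obtain ⟨enc, Q, hQ, hQ1, hs, hQt⟩ := hmem
  have hQsum : (∑ i, Q i).PosSemidef := posSemidef_sum _ fun i _ => hQ i
  refine ⟨∑ i, Q i, hQsum, hQ1, ?_, fun x => ?_⟩
  · rw [trace_sum, Complex.re_sum]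
    calc ∑ i, (Q i).trace.re ≤ ∑ _i : Fin (sSup s), (1 : ℝ) :=
          Finset.sum_le_sum fun i _ => hQt i
      _ = (sSup s : ℕ) := by simp
      _ ≤ Mcode W ε := by exact_mod_cast hle
  · by_contra! hx
    have hr : (W x * (1 - ∑ i, Q i)).trace.re = 1 - (W x * ∑ i, Q i).trace.re := by
      rw [Matrix.mul_sub, trace_sub, Matrix.mul_one, (hW x).2.2, Complex.sub_re, Complex.one_re]
    obtain ⟨Q', hQ', hle', ht', hs'⟩ := (hW x).exists_effect_le hQ1 (by simpa using hQsum)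
      (by rw [hr]; linarith)
    have : sSup s + 1 ∈ s := by
      refine ⟨Fin.cons x enc, Fin.cons Q' Q, Fin.cases hQ' hQ, ?_, Fin.cases ?_ hs,
        Fin.cases ht' hQt⟩
      · rw [Fin.sum_univ_succ]
        simp only [Fin.cons_zero, Fin.cons_succ]
        convert hle' using 1
        abel
      · simp only [Fin.cons_zero]
        rw [hs', hr]; linarith
    exact absurd (le_csSup hbdd this) (by simp)

variable [Fintype X]

/-- Direct part: a saturated code is tested against the Neyman–Pearson inequality. -/
theorem Hs_le_log_Mcode_sub_log [Nonempty X] (hW : ∀ x, IsPureState (W x)) {δ : ℝ}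
    (hδ : 0 < δ) (hδε : δ ≤ ε) (hε1 : ε < 1) {P : X → ℝ} (hP : ∀ x, 0 ≤ P x)
    (hP1 : ∑ x, P x = 1) :
    Hs (ε - δ) (WPavg P W) ≤ Real.log (Mcode W ε) - Real.log δ := by
  have hst := isState_WPavg hW hP hP1
  refine csSup_le (exists_mem_Hs_set hst.1 (posSemidef_one_sub_WPavg hW hP hP1) (by linarith))
    fun lam hlam => ?_
  rw [Set.mem_ofPred_eq] at hlam
  obtain ⟨Q, hQ, hQ1, hQt, hQW⟩ := exists_saturated_effect hW hε1
  have h1 := re_trace_mul_le_projNonneg hst.1.isHermitian (Real.exp_pos (-lam)).le hQ hQ1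
  have h2 : ε ≤ (WPavg P W * Q).trace.re := by
    rw [re_trace_WPavg_mul]
    calc ε = ∑ x, P x * ε := by rw [← Finset.sum_mul, hP1, one_mul]
      _ ≤ _ := Finset.sum_le_sum fun x _ => mul_le_mul_of_nonneg_left (hQW x) (hP x)
  have h3 : δ ≤ Real.exp (-lam) * Mcode W ε := by
    have := mul_le_mul_of_nonneg_left hQt (Real.exp_pos (-lam)).le
    linarith
  have hM : (0 : ℝ) < Mcode W ε := by
    exact_mod_cast one_le_Mcode hW (hδ.le.trans hδε) hε1
  have h4 := Real.log_le_log hδ h3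
  rw [Real.log_mul (Real.exp_pos _).ne' hM.ne', Real.log_exp] at h4
  linarith

/-- Converse part: `P` is the empirical distribution of the codewords. -/
theorem CodeAchievable.exists_log_le_Hs (hW : ∀ x, IsPureState (W x)) {M : ℕ} (hM : 1 ≤ M)
    (h : CodeAchievable W ε M) {δ₁ δ₂ : ℝ} (h1 : 0 < δ₁) (h1' : δ₁ < 1) (h2 : 0 < δ₂)
    (h2' : δ₂ < 1) (hlt : ε + δ₁ + 2 * δ₂ < 1) :
    ∃ P : X → ℝ, (∀ x, 0 ≤ P x) ∧ ∑ x, P x = 1 ∧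
      Real.log M ≤ Hs (ε + δ₁ + 2 * δ₂) (WPavg P W) + Real.log (1 / (δ₁ * δ₂ ^ 2)) := by
  classical
  obtain ⟨enc, Q, hQ, hQ1, hs⟩ := h
  have hM0 : (0 : ℝ) < M := by exact_mod_cast hM
  let P : X → ℝ := fun x => ∑ i, if enc i = x then (M : ℝ)⁻¹ else 0
  have hPsum : ∀ f : X → ℝ, ∑ x, P x * f x = (M : ℝ)⁻¹ * ∑ i, f (enc i) := fun f => by
    simp only [P, Finset.sum_mul, Finset.mul_sum, ite_mul, zero_mul]
    rw [Finset.sum_comm]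
    simp
  have hP : ∀ x, 0 ≤ P x := fun x => Finset.sum_nonneg fun i _ => by split_ifs <;> positivity
  have hP1 : ∑ x, P x = 1 := by
    have := hPsum fun _ => 1
    simpa [hM0.ne'] using this
  have hst := isState_WPavg hW hP hP1
  refine ⟨P, hP, hP1, ?_⟩
  have hΔ : 0 < M * (δ₁ * δ₂ ^ 2) := by positivity
  have hlog : Real.log (M * (δ₁ * δ₂ ^ 2)) = Real.log M - Real.log (1 / (δ₁ * δ₂ ^ 2)) := by
    rw [Real.log_mul hM0.ne' (by positivity), one_div, Real.log_inv, sub_neg_eq_add]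
  suffices hmem : Real.log (M * (δ₁ * δ₂ ^ 2)) ≤ Hs (ε + δ₁ + 2 * δ₂) (WPavg P W) by linarith
  refine le_csSup (bddAbove_Hs_set hst hlt) ?_
  rw [Set.mem_ofPred_eq, Real.exp_neg, Real.exp_log hΔ]
  have hcS := mul_re_trace_projNonneg_le (c := (M * (δ₁ * δ₂ ^ 2))⁻¹) hst.1.isHermitian
  set A := WPavg P W - (M * (δ₁ * δ₂ ^ 2))⁻¹ • (1 : Matrix n n ℂ)
  have hSH := projNonneg_isHermitian A
  have hSS := projNonneg_mul_self A
  set S := projNonneg A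
  have hS := hSH.posSemidef_of_mul_self hSS
  have hτ := re_trace_mul_le_re_trace hst.1 (hSH.posSemidef_one_sub_of_mul_self hSS)
  rw [hst.2, Complex.one_re] at hτ
  have htS : S.trace.re ≤ M * (δ₁ * δ₂ ^ 2) := by
    have := hcS.trans hτ
    rwa [inv_mul_le_iff₀ hΔ, mul_one] at this
  have hQi : ∀ i, (1 - Q i).PosSemidef := fun i => by
    have := hQ1.add (posSemidef_sum (Finset.univ.erase i) fun j _ => hQ j)
    convert this using 1
    rw [← Finset.add_sum_erase _ Q (Finset.mem_univ i)]
    abel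
  have hQS : ∑ i, (Q i * S).trace.re ≤ S.trace.re := by
    have := re_trace_mul_le_re_trace hS hQ1
    rwa [trace_mul_comm, Finset.sum_mul, trace_sum, Complex.re_sum] at this
  have hsum : ∑ i, ((1 - ε) + (1 + δ₂) * (W (enc i) * S).trace.re) ≤
      ∑ i, ((1 + 1 / δ₂) * (Q i * S).trace.re + (1 + δ₂)) :=
    Finset.sum_le_sum fun i _ => (add_le_add_left (hs i) _).trans
      (re_trace_mul_pinching_le (hW _).posSemidef (hW _).posSemidef_one_sub (hW _).2.2 (hQ i)
        (hQi i) hSH hSS h2)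
  have hτeq : ∑ i, (W (enc i) * S).trace.re = M * (WPavg P W * S).trace.re := by
    rw [re_trace_WPavg_mul, hPsum fun x => (W x * S).trace.re, mul_inv_cancel_left₀ hM0.ne']
  simp only [Finset.sum_add_distrib, ← Finset.mul_sum, Finset.sum_const, Finset.card_univ,
    Fintype.card_fin, nsmul_eq_mul, hτeq] at hsum
  have hτ0 : 0 ≤ (WPavg P W * S).trace.re := hst.1.re_trace_mul_nonneg hS
  set τ := (WPavg P W * S).trace.re
  have hq : (1 + 1 / δ₂) * ∑ i, (Q i * S).trace.re ≤ M * (δ₁ * δ₂ ^ 2 + δ₁ * δ₂) := by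
    calc _ ≤ (1 + 1 / δ₂) * (M * (δ₁ * δ₂ ^ 2)) :=
          mul_le_mul_of_nonneg_left (hQS.trans htS) (by positivity)
      _ = _ := by field_simp
  have hM' : (M : ℝ) * (1 - ε + (1 + δ₂) * τ) ≤
      M * (δ₁ * δ₂ ^ 2 + δ₁ * δ₂ + (1 + δ₂)) := by linarith
  have hfin := le_of_mul_le_mul_left hM' hM0
  have hd : 0 ≤ δ₂ * τ := by positivity
  have ha : δ₁ * δ₂ ≤ δ₂ := mul_le_of_le_one_left h2.le h1'.le
  have hb : δ₁ * δ₂ ^ 2 ≤ δ₁ := mul_le_of_le_one_right h1.le (pow_le_one₀ h2.le h2'.le)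
  linarith

end codes

/-- single-shot bounds for a pure-state cq-channel:
`max_P H_s^{ε−δ₁−δ₂}(W_P) − log((1−ε)/(δ₁δ₂)) ≤ log M(ε)` and
`log M(ε) ≤ max_P H_s^{ε+δ₁+2δ₂}(W_P) + log(1/(δ₁δ₂²))`. -/
theorem statement_2 {X : Type} [Fintype X] [DecidableEq X] [Nonempty X] {d : ℕ}
    (W : X → Matrix (Fin d) (Fin d) ℂ) (hW : ∀ x, IsPureState (W x))
    (ε δ₁ δ₂ : ℝ) (hε : ε ∈ Set.Ioo (0 : ℝ) 1)
    (h1 : δ₁ ∈ Set.Ioo (0 : ℝ) 1) (h2 : δ₂ ∈ Set.Ioo (0 : ℝ) 1)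
    (hlt : δ₁ + δ₂ < ε) (hlt2 : ε + δ₁ + 2 * δ₂ < 1) :
    sSup {t : ℝ | ∃ P : X → ℝ, (∀ x, 0 ≤ P x) ∧ (∑ x, P x) = 1 ∧
          t = Hs (ε - δ₁ - δ₂) (WPavg P W)}
        - Real.log ((1 - ε) / (δ₁ * δ₂))
      ≤ Real.log (Mcode W ε) ∧
    Real.log (Mcode W ε)
      ≤ sSup {t : ℝ | ∃ P : X → ℝ, (∀ x, 0 ≤ P x) ∧ (∑ x, P x) = 1 ∧
          t = Hs (ε + δ₁ + 2 * δ₂) (WPavg P W)}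
        + Real.log (1 / (δ₁ * δ₂ ^ 2)) := by
  have hδ : δ₁ + δ₂ ≤ ε := hlt.le
  have hε0 := hε.1
  have hε1 := hε.2
  have h10 := h1.1
  have h20 := h2.1
  constructor
  · rw [sub_le_iff_le_add]
    obtain ⟨P₀, hP₀, hP₀1⟩ : ∃ P : X → ℝ, (∀ x, 0 ≤ P x) ∧ ∑ x, P x = 1 :=
      ⟨Pi.single (Classical.arbitrary X) 1, fun x => by
        by_cases h : x = Classical.arbitrary X <;> simp [h], by simp⟩
    refine csSup_le ⟨_, P₀, hP₀, hP₀1, rfl⟩ ?_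
    rintro t ⟨P, hP, hP1, rfl⟩
    have h := Hs_le_log_Mcode_sub_log hW (add_pos h10 h20) hδ hε1 hP hP1
    rw [← sub_sub] at h
    have hinv : Real.log (1 / (δ₁ + δ₂)) ≤ Real.log ((1 - ε) / (δ₁ * δ₂)) := by
      refine Real.log_le_log (by positivity) ?_
      rw [div_le_div_iff₀ (by positivity) (by positivity)]
      nlinarith [h1.2, h2.2, mul_pos h10 h20]
    rw [one_div, Real.log_inv] at hinv
    linarith
  · obtain ⟨P, hP, hP1, h⟩ := (codeAchievable_Mcode hW hε0.le hε1).exists_log_le_Hs hW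
      (one_le_Mcode hW hε0.le hε1) h10 h1.2 h20 h2.2 hlt2
    refine h.trans (add_le_add_left (le_csSup ?_ (Set.mem_ofPred_eq ▸ ⟨P, hP, hP1, rfl⟩)) _)
    refine ⟨(Fintype.card (Fin d) : ℝ) / (1 - (ε + δ₁ + 2 * δ₂)), ?_⟩
    rintro t ⟨P', hP', hP1', rfl⟩
    have hst := isState_WPavg hW hP' hP1'
    exact csSup_le (exists_mem_Hs_set hst.1 (posSemidef_one_sub_WPavg hW hP' hP1') (by positivity))
      fun lam hlam => le_of_mem_Hs_set hst hlt2 hlam
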